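/- Let K be a nonempty half-plane hull and Ω = ℍ \ K. Let R ≥ 10·diam(K) and let z₀ ∈ Ω satisfy Im(z₀) ≥ R and dist(z₀,K) ≤ 100·R. Suppose there exist 0 < β ≤ 1 and C > 0 such that ρ_Ω(z₀,z) ≤ (1/β)·log(1/δ_Ω(z)) + C for all z ∈ Ω with dist(z,K) ≤ 10·diam(K). Then Ω is a (β,C')-Hölder domain, where C' > 0 depends only on β, C and R. -/

import Mathlib

open Set Metric Filter Bornology Complex Function

noncomputable section

/-- The upper half-plane as a subset of `ℂ`. -/
def UHP : Set ℂ := {z : ℂ | 0 < z.im}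

/-- `K` is a half-plane hull: a bounded subset of the upper half-plane whose
complement in the upper half-plane is a simply connected domain. -/
def IsHull (K : Set ℂ) : Prop :=
  IsBounded K ∧ K ⊆ UHP ∧ IsOpen (UHP \ K) ∧ IsConnected (UHP \ K) ∧
    SimplyConnectedSpace ↥(UHP \ K)

/-- `f` is the hydrodynamic conformal map of the hull `K`: a conformal bijection
from the upper half-plane onto `UHP \ K` with `f z - z → 0` as `|z| → ∞` in `UHP`. -/
def IsHydroMap (K : Set ℂ) (f : ℂ → ℂ) : Prop :=
  DifferentiableOn ℂ f UHP ∧ InjOn f UHP ∧ f '' UHP = UHP \ K ∧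
    Tendsto (fun z => f z - z) (cobounded ℂ ⊓ 𝓟 UHP) (nhds (0 : ℂ))

/-- `f` is the hydrodynamic map of `K` and `g` is its inverse. -/
def IsHydroPair (K : Set ℂ) (f g : ℂ → ℂ) : Prop :=
  IsHydroMap K f ∧ InvOn g f UHP (UHP \ K)

/-- `K` has half-plane capacity `a`, computed via its hydrodynamic map `f`:
`z * (z - f z) → a` as `|z| → ∞` in `UHP`. -/
def HasHcap (K : Set ℂ) (f : ℂ → ℂ) (a : ℝ) : Prop :=
  Tendsto (fun z => z * (z - f z)) (cobounded ℂ ⊓ 𝓟 UHP) (nhds (a : ℂ))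

/-- The `(β, C₀)`-Hölder condition for a map defined on the upper half-plane. -/
def IsHolder (f : ℂ → ℂ) (β C₀ : ℝ) : Prop :=
  ∀ z ∈ UHP, ∀ z' ∈ UHP, dist (f z) (f z') ≤ C₀ * max (dist z z' ^ β) (dist z z')

/-- The Poincaré hyperbolic distance on the upper half-plane. -/
def rhoH (z w : ℂ) : ℝ :=
  2 * Real.arsinh (dist z w / (2 * Real.sqrt (z.im * w.im)))

/-- The hyperbolic distance on a simply connected domain `Ω`, transported through a
conformal bijection `φ : UHP → Ω` (independent of the choice of `φ`). -/
def rhoVia (φ : ℂ → ℂ) (z w : ℂ) : ℝ :=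
  rhoH (invFunOn φ UHP z) (invFunOn φ UHP w)

/-- `log⁺ x = max (log x) 0`. -/
def posLog (x : ℝ) : ℝ := max (Real.log x) 0

/-- Internal distance between `A` and `B` inside `Ω`: the infimum of diameters of
connected subsets of `Ω` meeting both `A` and `B`. -/
def distIn (Ω A B : Set ℂ) : ℝ :=
  sInf {d : ℝ | ∃ E : Set ℂ, E ⊆ Ω ∧ IsConnected E ∧ (E ∩ A).Nonempty ∧
    (E ∩ B).Nonempty ∧ d = Metric.diam E}

/-- Internal diameter of `A` inside `Ω`. -/
def diamIn (Ω A : Set ℂ) : ℝ :=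
  sSup {d : ℝ | ∃ a ∈ A, ∃ b ∈ A, d = distIn Ω {a} {b}}

/-- An `L`-John curve in `Ω` with tip `z`, parametrized on `[0,1)` (the base-point,
which is not required to lie in `Ω`, corresponds to the missing endpoint). -/
def IsJohnCurve (Ω : Set ℂ) (L : ℝ) (α : ℝ → ℂ) (z : ℂ) : Prop :=
  ContinuousOn α (Ico 0 1) ∧ InjOn α (Ico 0 1) ∧ α 0 = z ∧
    MapsTo α (Ico 0 1) Ω ∧
    ∀ t ∈ Ico (0:ℝ) 1, Metric.diam (α '' Icc 0 t) ≤ L * infDist (α t) (frontier Ω)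

/-- An `L`-John curve in `Ω` with tip `z` and base-point `∞`, parametrized on `[0,∞)`. -/
def IsJohnCurveInfty (Ω : Set ℂ) (L : ℝ) (α : ℝ → ℂ) (z : ℂ) : Prop :=
  ContinuousOn α (Ici 0) ∧ InjOn α (Ici 0) ∧ α 0 = z ∧
    MapsTo α (Ici 0) Ω ∧ Tendsto α atTop (cobounded ℂ) ∧
    ∀ t ∈ Ici (0:ℝ), Metric.diam (α '' Icc 0 t) ≤ L * infDist (α t) (frontier Ω)

theorem aux_bloch_local {F : ℂ → ℂ} {c : ℂ} {ρ : ℝ} (hρ : 0 < ρ)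
    (hF : DifferentiableOn ℂ F (ball c ρ))
    (hb : ∀ z ∈ ball c ρ, ‖deriv F z‖ ≤ 2 * ‖deriv F c‖) (h0 : deriv F c ≠ 0) :
    ball (F c) (ρ * ‖deriv F c‖ / 24) ⊆ F '' ball c ρ := by
  set m := ‖deriv F c‖ with hm
  have hm0 : 0 < m := norm_pos_iff.mpr h0
  have hF' : DifferentiableOn ℂ (deriv F) (ball c ρ) := hF.deriv isOpen_ball
  have hsch : ∀ z ∈ ball c ρ, ‖deriv F z - deriv F c‖ ≤ 3 * m / ρ * dist z c := by
    intro z hz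
    rw [← dist_eq_norm]
    refine Complex.dist_le_div_mul_dist_of_mapsTo_ball hF' ?_ hz
    intro w hw
    rw [mem_closedBall, dist_eq_norm]
    calc ‖deriv F w - deriv F c‖ ≤ ‖deriv F w‖ + ‖deriv F c‖ := norm_sub_le _ _
      _ ≤ 3 * m := by linarith [hb w hw]
  have hsub : closedBall c (ρ/6) ⊆ ball c ρ := closedBall_subset_ball (by linarith)
  have hlow : ∀ z ∈ sphere c (ρ/6), ρ * m / 12 ≤ ‖F z - F c‖ := by
    intro z hz
    have hz' : dist z c = ρ / 6 := hz
    have hmv : ‖(F z - deriv F c * z) - (F c - deriv F c * c)‖ ≤ (m / 2) * ‖z - c‖ := by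
      refine (convex_closedBall c (ρ/6)).norm_image_sub_le_of_norm_hasDerivWithin_le
        (f := fun u => F u - deriv F c * u) (f' := fun u => deriv F u - deriv F c)
        ?_ ?_ (mem_closedBall_self (by positivity)) (sphere_subset_closedBall hz)
      · intro x hx
        have h1 : HasDerivAt F (deriv F x) x :=
          (hF.differentiableAt (isOpen_ball.mem_nhds (hsub hx))).hasDerivAt
        have h2 : HasDerivAt (fun u : ℂ => deriv F c * u) (deriv F c) x := by
          simpa using (hasDerivAt_id x).const_mul (deriv F c)
        exact (h1.sub h2).hasDerivWithinAt
      · intro x hx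
        refine (hsch x (hsub hx)).trans ?_
        have : dist x c ≤ ρ/6 := hx
        calc 3 * m / ρ * dist x c ≤ 3 * m / ρ * (ρ/6) := by gcongr
          _ = m / 2 := by field_simp; norm_num
    rw [← dist_eq_norm z c, hz'] at hmv
    have e : F z - F c = ((F z - deriv F c * z) - (F c - deriv F c * c)) + deriv F c * (z - c) := by
      ring
    have h3 : ‖deriv F c * (z - c)‖ = m * (ρ/6) := by
      rw [norm_mul, ← dist_eq_norm z c, hz']
    have h4 : ‖deriv F c * (z - c)‖ ≤ ‖F z - F c‖ +
        ‖(F z - deriv F c * z) - (F c - deriv F c * c)‖ := by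
      have : deriv F c * (z - c) = (F z - F c) -
        ((F z - deriv F c * z) - (F c - deriv F c * c)) := by ring
      rw [this]; exact norm_sub_le _ _
    rw [h3] at h4
    linarith
  have hd : DiffContOnCl ℂ F (ball c (ρ/6)) := by
    apply DifferentiableOn.diffContOnCl
    rw [closure_ball _ (by positivity)]
    exact hF.mono hsub
  have hfreq : ∃ᶠ z in nhds c, F z ≠ F c := by
    intro hev
    have : F =ᶠ[nhds c] fun _ => F c := by
      filter_upwards [hev] with z hz using not_not.mp hz
    apply h0
    rw [this.deriv_eq]; simp
  have := hd.ball_subset_image_closedBall (by positivity) hlow hfreq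
  have e : ρ * m / 24 = ρ * m / 12 / 2 := by ring
  rw [e]
  exact this.trans (image_mono hsub)

theorem aux_bloch {F : ℂ → ℂ} {c : ℂ} {r : ℝ} (hr : 0 < r)
    (hF : DifferentiableOn ℂ F (ball c r)) (h0 : deriv F c ≠ 0) :
    ∃ b, ball b (r * ‖deriv F c‖ / 96) ⊆ F '' ball c r := by
  have hF' : DifferentiableOn ℂ (deriv F) (ball c r) := hF.deriv isOpen_ball
  have hsub : closedBall c (r/2) ⊆ ball c r := closedBall_subset_ball (by linarith)
  set φ : ℂ → ℝ := fun z => ‖deriv F z‖ * (r/2 - dist z c) with hφ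
  have hcont : ContinuousOn φ (closedBall c (r/2)) := by
    apply ContinuousOn.mul
    · exact (hF'.continuousOn.mono hsub).norm
    · fun_prop
  obtain ⟨z1, hz1, hmax⟩ := (isCompact_closedBall c (r/2)).exists_isMaxOn
    ⟨c, mem_closedBall_self (by positivity)⟩ hcont
  have hmc : φ c ≤ φ z1 := hmax (mem_closedBall_self (by positivity))
  have hm0 : 0 < ‖deriv F c‖ := norm_pos_iff.mpr h0
  have hφc : φ c = ‖deriv F c‖ * (r/2) := by simp [hφ]
  have hpos : 0 < φ z1 := lt_of_lt_of_le (by rw [hφc]; positivity) hmc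
  set t := r/2 - dist z1 c with ht
  have ht0 : 0 < t := by
    by_contra hneg
    have : φ z1 ≤ 0 := mul_nonpos_of_nonneg_of_nonpos (norm_nonneg _) (not_lt.mp hneg)
    linarith
  have hball : ball z1 (t/2) ⊆ closedBall c (r/2) := by
    intro z hz
    have : dist z z1 < t/2 := hz
    have := dist_triangle z z1 c
    rw [mem_closedBall]; linarith
  have hd1 : deriv F z1 ≠ 0 := by
    intro h
    simp [hφ, h] at hpos
  have := aux_bloch_local (F := F) (c := z1) (ρ := t/2) (by positivity)
    (hF.mono (hball.trans hsub)) (by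
      intro z hz
      have h1 : φ z ≤ φ z1 := hmax (hball hz)
      have h2 : dist z z1 < t/2 := hz
      have h3 := dist_triangle z z1 c
      have h4 : t/2 ≤ r/2 - dist z c := by linarith
      have h5 : ‖deriv F z‖ * (t/2) ≤ φ z := by
        simp only [hφ]; gcongr
      have h6 : φ z1 = ‖deriv F z1‖ * t := rfl
      by_contra hc
      push Not at hc
      nlinarith) hd1
  refine ⟨F z1, (ball_subset_ball ?_).trans (this.trans (image_mono (hball.trans hsub)))⟩
  have h6 : φ z1 = ‖deriv F z1‖ * t := rfl
  rw [hφc, h6] at hmc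
  linarith

/-- A weak form of the Koebe distortion theorem. -/
theorem aux_koebe {h : ℂ → ℂ} {w a : ℂ} {r : ℝ} (hr : 0 < r)
    (hd : DifferentiableOn ℂ h (ball w r)) (hinj : InjOn h (ball w r))
    (ha : a ∉ h '' ball w r) : ‖deriv h w‖ * r ≤ 400 * ‖h w - a‖ := by
  have hw : w ∈ ball w r := mem_ball_self hr
  have hne : ∀ z ∈ ball w r, h z - a ≠ 0 := by
    intro z hz h0
    exact ha ⟨z, hz, sub_eq_zero.mp h0⟩
  have hq : DifferentiableOn ℂ (fun z => deriv h z / (h z - a)) (ball w r) :=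
    (hd.deriv isOpen_ball).div (hd.sub_const a) hne
  obtain ⟨L, hL⟩ := hq.isExactOn_ball
  have hLd : DifferentiableOn ℂ L (ball w r) :=
    fun z hz => (hL z hz).differentiableAt.differentiableWithinAt
  by_cases h0 : deriv h w = 0
  · rw [h0]; simp
  have hpos := norm_pos_iff.mpr (hne w hw)
  have hdL : deriv L w = deriv h w / (h w - a) := (hL w hw).deriv
  have hdL0 : deriv L w ≠ 0 := by rw [hdL]; exact div_ne_zero h0 (hne w hw)
  -- `exp L` is a constant multiple of `h - a`
  have hconst : ∀ z ∈ ball w r, Complex.exp (-L z) * (h z - a) =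
      Complex.exp (-L w) * (h w - a) := by
    intro z hz
    refine isOpen_ball.is_const_of_deriv_eq_zero (𝕜 := ℂ)
      (f := fun z => Complex.exp (-L z) * (h z - a))
      (convex_ball w r).isPreconnected ?_ ?_ hz hw
    · exact (hLd.neg.cexp).mul (hd.sub_const a)
    · intro x hx
      have h1 : HasDerivAt h (deriv h x) x :=
        (hd.differentiableAt (isOpen_ball.mem_nhds hx)).hasDerivAt
      have h2 := ((hL x hx).neg.cexp).mul (h1.sub_const a)
      have h3 := h2.deriv
      have h4 := hne x hx
      simp only [Pi.zero_apply]
      refine Eq.trans h3 ?_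
      simp only [Pi.neg_apply]
      field_simp
      ring
  obtain ⟨b, hb⟩ := aux_bloch hr hLd hdL0
  have hkey : r * ‖deriv L w‖ / 96 ≤ 4 := by
    by_contra hcon
    push Not at hcon
    have hpi := Real.pi_lt_d2
    have hpi0 := Real.pi_pos
    have m1 : b + Real.pi * I ∈ ball b (r * ‖deriv L w‖ / 96) := by
      rw [mem_ball, dist_eq_norm]
      simp [abs_of_pos hpi0]; linarith
    have m2 : b - Real.pi * I ∈ ball b (r * ‖deriv L w‖ / 96) := by
      rw [mem_ball, dist_eq_norm]
      simp [abs_of_pos hpi0]; linarith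
    obtain ⟨p, hp, hp'⟩ := hb m1
    obtain ⟨q, hq, hq'⟩ := hb m2
    have e1 := hconst p hp
    have e2 := hconst q hq
    have e3 : Complex.exp (-L p) = Complex.exp (-L q) := by
      rw [Complex.exp_eq_exp_iff_exists_int]
      refine ⟨-1, ?_⟩
      rw [hp', hq']; push_cast; ring
    rw [← e2, e3] at e1
    have e4 := mul_left_cancel₀ (Complex.exp_ne_zero _) e1
    have e5 : p = q := hinj hp hq (by linear_combination e4)
    rw [e5, hq'] at hp'
    have : (Real.pi : ℂ) * I = 0 := by linear_combination (-1/2 : ℂ) * hp'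
    simp [hpi0.ne'] at this
  rw [hdL, norm_div] at hkey
  have : r * ‖deriv h w‖ / ‖h w - a‖ ≤ 384 := by
    have : r * (‖deriv h w‖ / ‖h w - a‖) = r * ‖deriv h w‖ / ‖h w - a‖ := by ring
    linarith
  rw [div_le_iff₀ hpos] at this
  linarith

theorem aux_isOpen_UHP : IsOpen UHP := isOpen_lt continuous_const Complex.continuous_im

theorem aux_hull_touch {K : Set ℂ} (hK : IsHull K) (hne : K.Nonempty) :
    ∃ p ∈ closure K, p.im = 0 := by
  obtain ⟨hbd, hsub, hopen, hconn, hsc⟩ := hK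
  have hcomp : IsCompact (closure K) := hbd.isCompact_closure
  obtain ⟨p, hp, hmin⟩ := hcomp.exists_isMinOn hne.closure Complex.continuous_im.continuousOn
  refine ⟨p, hp, ?_⟩
  have hp0 : 0 ≤ p.im := by
    have hcl : IsClosed {z : ℂ | 0 ≤ z.im} := isClosed_le continuous_const Complex.continuous_im
    have : closure K ⊆ {z : ℂ | 0 ≤ z.im} := closure_minimal (fun z hz => show 0 ≤ z.im from le_of_lt (hsub hz)) hcl
    exact this hp
  by_contra hpne
  set ε := p.im with hε
  have hε0 : 0 < ε := lt_of_le_of_ne hp0 (Ne.symm hpne)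
  have hKε : ∀ k ∈ K, ε ≤ k.im := fun k hk => hmin (subset_closure hk)
  obtain ⟨M, hM⟩ := isBounded_iff_forall_norm_le.mp hbd
  obtain ⟨k0, hk0⟩ := hne
  set T := (M^2 + 1)/ε + ε with hT
  have hTε : M^2 + 1 + ε^2 = T * ε := by rw [hT]; field_simp
  have hT0 : ε ≤ T := by rw [hT]; have : 0 ≤ (M^2+1)/ε := by positivity
                         linarith
  set r := T - ε/2 with hr
  have hr0 : 0 < r := by linarith
  have hKball : ∀ k ∈ K, k ∈ ball (T * I) r := by
    intro k hk
    rw [mem_ball, dist_eq_norm]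
    have h1 := hKε k hk
    have h2 := hM k hk
    have h3 : ‖k‖^2 = k.re^2 + k.im^2 := by
      rw [Complex.sq_norm, Complex.normSq_apply]; ring
    have h4 : ‖k - T * I‖^2 = k.re^2 + (k.im - T)^2 := by
      rw [Complex.sq_norm, Complex.normSq_apply]; simp; ring
    have h5 : ‖k‖^2 ≤ M^2 := by gcongr
    have h6 : T * ε ≤ T * k.im := by gcongr
    refine lt_of_pow_lt_pow_left₀ 2 hr0.le ?_
    rw [h4, hr]
    nlinarith
  have hsph : sphere (T * I) r ⊆ UHP \ K := by
    intro z hz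
    have hz' : dist z (T * I) = r := hz
    refine ⟨?_, ?_⟩
    · have h1 := Complex.abs_im_le_norm (z - T * I)
      rw [← dist_eq_norm, hz'] at h1
      simp at h1
      have := (abs_le.mp h1).1
      change 0 < z.im
      linarith
    · intro hk
      have h2 : dist z (T * I) < r := hKball z hk
      linarith
  have hs : IsSimplyConnected (UHP \ K) := hsc
  obtain ⟨L, hLc, hL⟩ := Complex.exists_continuousOn_eqOn_exp_comp (g := fun z => z - k0) hs hopen
    (by fun_prop) (by
      rintro ⟨z, hz, h0⟩
      exact hz.2 (by rw [sub_eq_zero.mp h0]; exact hk0))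
  have hder : ∀ z ∈ sphere (T * I) r, HasDerivWithinAt L ((z - k0)⁻¹) (sphere (T * I) r) z := by
    intro z hz
    have hzΩ := hsph hz
    have hnb : UHP \ K ∈ nhds z := hopen.mem_nhds hzΩ
    have e1 : Complex.exp (L z) = z - k0 := hL hzΩ
    have hne : z - k0 ≠ 0 := by rw [← e1]; exact Complex.exp_ne_zero _
    have h1 : HasDerivAt (fun u => Complex.exp u + k0) (z - k0) (L z) := by
      have := (Complex.hasDerivAt_exp (L z)).add_const k0
      rwa [e1] at this
    refine (HasDerivAt.of_local_left_inverse (hLc.continuousAt hnb) h1 hne ?_).hasDerivWithinAt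
    filter_upwards [hnb] with y hy
    have : Complex.exp (L y) = y - k0 := hL hy
    rw [this]; ring
  have h1 := circleIntegral.integral_eq_zero_of_hasDerivWithinAt hr0.le hder
  rw [circleIntegral.integral_sub_inv_of_mem_ball (hKball k0 hk0)] at h1
  simp [Real.pi_ne_zero] at h1

theorem aux_maxprin {U : Set ℂ} {G : ℂ → ℂ} (hU : IsOpen U) (hG : DifferentiableOn ℂ G U)
    (hc : ∀ ε > 0, IsCompact {w | w ∈ U ∧ ε ≤ (G w).im}) : ∀ w ∈ U, (G w).im ≤ 0 := by
  intro w0 hw0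
  by_contra hpos
  push Not at hpos
  have hcont : ContinuousOn (fun w => (G w).im) U :=
    Complex.continuous_im.comp_continuousOn hG.continuousOn
  obtain ⟨w1, hw1, hmax⟩ := (hc _ hpos).exists_isMaxOn ⟨w0, hw0, le_rfl⟩
    (hcont.mono (fun w hw => hw.1))
  set m := (G w1).im with hm
  have hm0 : (G w0).im ≤ m := hmax ⟨hw0, le_rfl⟩
  have hle : ∀ u ∈ U, (G u).im ≤ m := by
    intro u hu
    by_cases h : (G w0).im ≤ (G u).im
    · exact hmax ⟨hu, h⟩
    · linarith
  have hcT := hc m (by linarith)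
  have hTo : IsOpen {w | w ∈ U ∧ m ≤ (G w).im} := by
    rw [isOpen_iff_mem_nhds]
    rintro w ⟨hw, hwm⟩
    have hwm' : (G w).im = m := le_antisymm (hle w hw) hwm
    have hnb := hU.mem_nhds hw
    have hnorm : ∀ u, ‖Complex.exp (-I * G u)‖ = Real.exp ((G u).im) := by
      intro u; rw [Complex.norm_exp]; simp
    have := Complex.norm_eventually_eq_of_isLocalMax (f := fun u => Complex.exp (-I * G u)) (c := w)
      (by
        filter_upwards [hnb] with u hu
        exact ((hG.differentiableAt (hU.mem_nhds hu)).const_mul (-I)).cexp)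
      (by
        filter_upwards [hnb] with u hu
        simp only [Function.comp, hnorm]
        rw [hwm']
        exact Real.exp_le_exp.mpr (hle u hu))
    filter_upwards [this, hnb] with u hu hu'
    refine ⟨hu', ?_⟩
    rw [hnorm, hnorm] at hu
    have := Real.exp_injective hu
    linarith
  have hclopen : IsClopen {w | w ∈ U ∧ m ≤ (G w).im} := ⟨hcT.isClosed, hTo⟩
  rcases isClopen_iff.mp hclopen with h | h
  · have : w1 ∈ {w | w ∈ U ∧ m ≤ (G w).im} := ⟨hw1.1, le_rfl⟩
    rw [h] at this; exact this
  · rw [h] at hcT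
    exact noncompact_univ ℂ hcT

theorem aux_inv_cont {K : Set ℂ} {f g : ℂ → ℂ} (hp : IsHydroPair K f g) (hopen : IsOpen (UHP \ K)) :
    MapsTo f UHP (UHP \ K) ∧ MapsTo g (UHP \ K) UHP ∧ ContinuousOn g (UHP \ K) := by
  obtain ⟨⟨hd, hinj, himg, -⟩, hl, hr⟩ := hp
  have hmf : MapsTo f UHP (UHP \ K) := fun w hw => himg ▸ mem_image_of_mem f hw
  have hmg : MapsTo g (UHP \ K) UHP := by
    intro z hz
    rw [← himg] at hz
    obtain ⟨w, hw, rfl⟩ := hz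
    rw [hl hw]; exact hw
  refine ⟨hmf, hmg, ?_⟩
  have han : AnalyticOnNhd ℂ f UHP := hd.analyticOnNhd aux_isOpen_UHP
  intro z hz
  apply ContinuousAt.continuousWithinAt
  have hw := hmg hz
  have hfw : f (g z) = z := hr hz
  have hmap := (han (g z) hw).eventually_constant_or_nhds_le_map_nhds.resolve_left (by
    intro hev
    have hb : ∀ᶠ u in nhds (g z), u ∈ UHP := aux_isOpen_UHP.mem_nhds hw
    have h3 : ∀ᶠ u in nhds (g z), u = g z := by
      filter_upwards [hev, hb] with u hu hu' using hinj hu' hw hu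
    have : ({g z} : Set ℂ) ∈ nhds (g z) := h3
    have h4 : IsOpen ({g z} : Set ℂ) := by
      rw [isOpen_iff_mem_nhds]; rintro x rfl; exact this
    exact not_isOpen_singleton _ h4)
  rw [hfw] at hmap
  intro N hN
  have h1 : N ∩ UHP ∈ nhds (g z) := inter_mem hN (aux_isOpen_UHP.mem_nhds hw)
  have h2 : f '' (N ∩ UHP) ∈ nhds z := hmap (image_mem_map h1)
  change ∀ᶠ y in nhds z, g y ∈ N
  filter_upwards [h2] with y hy
  obtain ⟨u, hu, rfl⟩ := hy
  change g (f u) ∈ N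
  rw [hl hu.2]; exact hu.1

theorem aux_far_preconn {r : ℝ} (hr : 0 < r) : IsPreconnected {z : ℂ | r < ‖z‖ ∧ 0 < z.im} := by
  have e : {z : ℂ | r < ‖z‖ ∧ 0 < z.im} =
      Complex.exp '' ({z : ℂ | Real.log r < z.re} ∩ ({z : ℂ | 0 < z.im} ∩ {z : ℂ | z.im < Real.pi})) := by
    ext z
    constructor
    · rintro ⟨h1, h2⟩
      have hz0 : z ≠ 0 := by rintro rfl; simp at h2
      refine ⟨Complex.log z, ⟨?_, ?_, ?_⟩, Complex.exp_log hz0⟩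
      · change Real.log r < (Complex.log z).re
        rw [Complex.log_re]; exact Real.log_lt_log hr h1
      · change 0 < (Complex.log z).im
        rw [Complex.log_im]
        rcases (Complex.arg_nonneg_iff.mpr h2.le).lt_or_eq with h | h
        · exact h
        · have := (Complex.arg_eq_zero_iff.mp h.symm).2
          linarith
      · change (Complex.log z).im < Real.pi
        rw [Complex.log_im]
        rcases (Complex.arg_le_pi z).lt_or_eq with h | h
        · exact h
        · have := (Complex.arg_eq_pi_iff.mp h).2
          linarith
    · rintro ⟨u, ⟨h1, h2, h3⟩, rfl⟩
      refine ⟨?_, ?_⟩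
      · rw [Complex.norm_exp]; exact (Real.log_lt_iff_lt_exp hr).mp h1
      · rw [Complex.exp_im]
        exact mul_pos (Real.exp_pos _) (Real.sin_pos_of_pos_of_lt_pi h2 h3)
  rw [e]
  apply IsPreconnected.image _ _ Complex.continuous_exp.continuousOn
  apply Convex.isPreconnected
  exact (convex_halfSpace_re_gt _).inter ((convex_halfSpace_im_gt _).inter (convex_halfSpace_im_lt _))

theorem aux_asymp {K : Set ℂ} {f : ℂ → ℂ} (hf : IsHydroMap K f) {ε : ℝ} (hε : 0 < ε) :
    ∃ M : ℝ, ∀ w ∈ UHP, M ≤ ‖w‖ → ‖f w - w‖ < ε := by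
  have h := hf.2.2.2
  have h1 : ∀ᶠ w in cobounded ℂ ⊓ 𝓟 UHP, f w - w ∈ ball (0:ℂ) ε := h (ball_mem_nhds _ hε)
  rw [eventually_inf_principal] at h1
  obtain ⟨M, -, hM⟩ := (hasBasis_cobounded_norm (E := ℂ)).eventually_iff.mp h1
  exact ⟨M, fun w hw hMw => by simpa using hM hMw hw⟩

theorem aux_bounded {K : Set ℂ} {f g : ℂ → ℂ} (hK : IsHull K) (hp : IsHydroPair K f g) (M : ℝ) :
    ∃ M', ∀ w ∈ UHP, ‖w‖ ≤ M → ‖f w‖ ≤ M' := by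
  obtain ⟨hmf, hmg, hgc⟩ := aux_inv_cont hp hK.2.2.1
  obtain ⟨M0, hM0⟩ := aux_asymp hp.1 one_pos
  obtain ⟨Mk, hMk⟩ := isBounded_iff_forall_norm_le.mp hK.1
  set M1 := max (max M M0) 0 + 1 with hM1
  have hMM1 : M < M1 := by have := le_max_left (max M M0) 0; have := le_max_left M M0; linarith
  have hM0M1 : M0 < M1 := by have := le_max_left (max M M0) 0; have := le_max_right M M0; linarith
  have hM1p : 0 < M1 := by have := le_max_right (max M M0) 0; linarith
  set r := M1 + 2 + |Mk| with hr
  have hr0 : 0 < r := by positivity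
  refine ⟨r, ?_⟩
  intro w hw hwM
  by_contra hcon
  push Not at hcon
  have hA := aux_far_preconn hr0
  set A := {z : ℂ | r < ‖z‖ ∧ 0 < z.im} with hAdef
  have hAΩ : A ⊆ UHP \ K := by
    rintro z ⟨h1, h2⟩
    refine ⟨h2, fun hk => ?_⟩
    have := hMk z hk
    have := le_abs_self Mk
    linarith
  have hwA : f w ∈ A := ⟨hcon, (hmf hw).1⟩
  set v : ℂ := ((r + 2 : ℝ) : ℂ) * I with hv
  have hvn : ‖v‖ = r + 2 := by
    rw [hv, norm_mul, Complex.norm_I, Complex.norm_real, Real.norm_eq_abs, abs_of_pos (by linarith)]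
    ring
  have hvU : v ∈ UHP := by
    change 0 < v.im
    rw [hv]; simp; linarith
  have hMkn := abs_nonneg Mk
  have hfv := hM0 v hvU (by rw [hvn]; linarith)
  have hvA : f v ∈ A := by
    refine ⟨?_, (hmf hvU).1⟩
    have : ‖v‖ ≤ ‖f v‖ + ‖f v - v‖ := by
      have e : v = f v - (f v - v) := by ring
      calc ‖v‖ = ‖f v - (f v - v)‖ := by rw [← e]
        _ ≤ _ := norm_sub_le _ _
    linarith
  have hiv := hA.intermediate_value hwA hvA (f := fun z => ‖g z‖) ((hgc.mono hAΩ).norm)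
  have hin : M1 ∈ Icc ‖g (f w)‖ ‖g (f v)‖ := by
    rw [hp.2.1 hw, hp.2.1 hvU, hvn]
    constructor <;> linarith
  obtain ⟨z, hzA, hz⟩ := hiv hin
  have hz' : ‖g z‖ = M1 := hz
  have h1 := hM0 (g z) (hmg (hAΩ hzA)) (by linarith)
  rw [hp.2.2 (hAΩ hzA)] at h1
  have h2 : ‖z‖ ≤ ‖z - g z‖ + ‖g z‖ := by
    calc ‖z‖ = ‖(z - g z) + g z‖ := by rw [sub_add_cancel]
      _ ≤ _ := norm_add_le _ _
  have := hzA.1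
  linarith

theorem aux_im_formula (c : ℝ) (b p : ℂ) (hp : p.im = 0) :
    ((c : ℂ) * (b - p)⁻¹).im = - (c * b.im / ‖b - p‖^2) := by
  rw [Complex.im_ofReal_mul, Complex.inv_im, Complex.sq_norm]
  simp [hp]; ring

theorem aux_growth {K : Set ℂ} {f g : ℂ → ℂ} (hK : IsHull K) (hp : IsHydroPair K f g)
    {p : ℂ} {d : ℝ} (hd : 0 < d) (hp0 : p.im = 0) (hKp : ∀ k ∈ K, ‖k - p‖ ≤ d) :
    ∀ w ∈ UHP, 4 * d ≤ ‖f w - p‖ → (f w).im ≤ 2 * w.im := by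
  obtain ⟨hmf, hmg, hgc⟩ := aux_inv_cont hp hK.2.2.1
  have hfd := hp.1.1
  set c : ℝ := 4 * d^2 with hc
  have hc0 : 0 < c := by positivity
  set U : Set ℂ := {w | w ∈ UHP ∧ 2 * d < ‖f w - p‖} with hUdef
  set G : ℂ → ℂ := fun w => f w - w + (c : ℂ) * (f w - p)⁻¹ with hGdef
  have hGim : ∀ w, (G w).im = (f w).im - w.im - c * (f w).im / ‖f w - p‖^2 := by
    intro w
    rw [hGdef]
    simp only [Complex.add_im, Complex.sub_im, aux_im_formula c _ p hp0]
    ring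
  have hUsub : U ⊆ UHP := fun w hw => hw.1
  have hU : IsOpen U := by
    have : U = UHP ∩ (fun w => ‖f w - p‖) ⁻¹' Ioi (2*d) := by ext; rfl
    rw [this]
    exact (hfd.continuousOn.sub continuousOn_const).norm.isOpen_inter_preimage
      aux_isOpen_UHP isOpen_Ioi
  have hG : DifferentiableOn ℂ G U := by
    have hf' := hfd.mono hUsub
    refine (hf'.sub differentiableOn_id).add ((DifferentiableOn.inv (hf'.sub_const p) ?_).const_mul _)
    intro w hw h0
    have := hw.2
    rw [h0] at this
    simp at this; linarith
  have hcpt : ∀ ε > 0, IsCompact {w | w ∈ U ∧ ε ≤ (G w).im} := by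
    intro ε hε
    obtain ⟨M, hM⟩ := aux_asymp hp.1 hε
    obtain ⟨M', hM'⟩ := aux_bounded hK hp M
    apply IsSeqCompact.isCompact
    intro u hu
    have hub : ∀ n, ‖u n‖ ≤ M := by
      intro n
      by_contra hcon
      push Not at hcon
      have h1 := hM (u n) (hu n).1.1 hcon.le
      have h2 := (hu n).2
      rw [hGim] at h2
      have h3 := Complex.abs_im_le_norm (f (u n) - u n)
      have h4 := (abs_le.mp h3).2
      rw [Complex.sub_im] at h4
      have h5 : 0 ≤ c * (f (u n)).im / ‖f (u n) - p‖^2 := by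
        have : 0 < (f (u n)).im := (hmf (hu n).1.1).1
        positivity
      linarith
    have hfb : ∀ n, ‖f (u n)‖ ≤ M' := fun n => hM' _ (hu n).1.1 (hub n)
    obtain ⟨⟨a, b⟩, -, φ, hφ, hlim⟩ := ((isCompact_closedBall (0:ℂ) M).prod
      (isCompact_closedBall (0:ℂ) M')).tendsto_subseq (x := fun n => (u n, f (u n)))
      (fun n => ⟨by simpa using hub n, by simpa using hfb n⟩)
    have hla : Tendsto (fun n => u (φ n)) atTop (nhds a) :=
      (continuous_fst.tendsto _).comp hlim
    have hlb : Tendsto (fun n => f (u (φ n))) atTop (nhds b) :=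
      (continuous_snd.tendsto _).comp hlim
    have hnb : 2 * d ≤ ‖b - p‖ :=
      ge_of_tendsto' (hlb.sub_const p).norm (fun n => (hu (φ n)).1.2.le)
    have hnb0 : 0 < ‖b - p‖ := by linarith
    have ha0 : 0 ≤ a.im := ge_of_tendsto' ((Complex.continuous_im.tendsto a).comp hla)
      (fun n => ((hu (φ n)).1.1 : 0 < (u (φ n)).im).le)
    have hb0 : 0 ≤ b.im := ge_of_tendsto' ((Complex.continuous_im.tendsto b).comp hlb)
      (fun n => (hmf (hu (φ n)).1.1).1.le)
    have hlimG : ε ≤ b.im - a.im - c * b.im / ‖b - p‖^2 := by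
      refine ge_of_tendsto' (((((Complex.continuous_im.tendsto b).comp hlb).sub
        ((Complex.continuous_im.tendsto a).comp hla))).sub
        (((((Complex.continuous_im.tendsto b).comp hlb)).const_mul c).div
          ((hlb.sub_const p).norm.pow 2) (by positivity))) (fun n => ?_)
      have := (hu (φ n)).2
      rw [hGim] at this
      exact this
    have hbpos : 0 < b.im := by
      rcases hb0.lt_or_eq with h | h
      · exact h
      · rw [← h] at hlimG; simp at hlimG; linarith
    have hbΩ : b ∈ UHP \ K := by
      refine ⟨hbpos, fun hk => ?_⟩
      have := hKp b hk
      linarith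
    have hga : a = g b := by
      have h1 : Tendsto (fun n => g (f (u (φ n)))) atTop (nhds (g b)) :=
        (hgc.continuousAt (hK.2.2.1.mem_nhds hbΩ)).tendsto.comp hlb
      have h2 : (fun n => g (f (u (φ n)))) = fun n => u (φ n) := by
        ext n; exact hp.2.1 (hu (φ n)).1.1
      rw [h2] at h1
      exact tendsto_nhds_unique hla h1
    have haU : a ∈ UHP := by rw [hga]; exact hmg hbΩ
    have hfa : f a = b := by rw [hga]; exact hp.2.2 hbΩ
    refine ⟨a, ⟨⟨haU, ?_⟩, ?_⟩, φ, hφ, hla⟩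
    · rw [hfa]
      rcases hnb.lt_or_eq with h | h
      · exact h
      · exfalso
        rw [← h] at hlimG
        have : c * b.im / (2*d)^2 = b.im := by rw [hc]; field_simp; norm_num
        rw [this] at hlimG
        have : 0 < a.im := haU
        linarith
    · rw [hGim, hfa]; exact hlimG
  intro w hw h4
  have h1 := aux_maxprin hU hG hcpt w ⟨hw, by linarith⟩
  rw [hGim] at h1
  have him : 0 < (f w).im := (hmf hw).1
  have hpos : 0 < ‖f w - p‖ := by linarith
  have h2 : c * (f w).im / ‖f w - p‖^2 ≤ (f w).im / 4 := by
    rw [div_le_iff₀ (by positivity), hc]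
    have : (4*d)^2 ≤ ‖f w - p‖^2 := by gcongr
    nlinarith
  linarith

theorem aux_rho {w0 w : ℂ} (h0 : 0 < w0.im) (h : 0 < w.im) :
    Real.log (w0.im / w.im) ≤ rhoH w0 w := by
  unfold rhoH
  set a := w0.im with ha
  set b := w.im with hb
  set s := Real.sqrt (a * b) with hs
  have hs0 : 0 < s := Real.sqrt_pos.mpr (by positivity)
  have hlogs : Real.log s = (Real.log a + Real.log b)/2 := by
    rw [hs, Real.log_sqrt (by positivity), Real.log_mul h0.ne' h.ne']
  set x := Real.log (a / b) / 2 with hx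
  have hx' : x = (Real.log a - Real.log b)/2 := by rw [hx, Real.log_div h0.ne' h.ne']
  have e1 : Real.exp x = a / s := by
    rw [← Real.exp_log (show 0 < a / s by positivity), Real.log_div h0.ne' hs0.ne', hlogs, hx']
    congr 1; ring
  have e2 : Real.exp (-x) = b / s := by
    rw [← Real.exp_log (show 0 < b / s by positivity), Real.log_div h.ne' hs0.ne', hlogs, hx']
    congr 1; ring
  have h1 : Real.sinh x ≤ dist w0 w / (2 * s) := by
    rw [Real.sinh_eq, e1, e2]
    have h2 : a - b ≤ dist w0 w := by
      have := Complex.abs_im_le_norm (w0 - w)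
      rw [← dist_eq_norm, Complex.sub_im] at this
      exact (le_abs_self _).trans this
    have : (a / s - b / s)/2 = (a - b)/(2*s) := by field_simp
    rw [this]
    gcongr
  have h2 : x ≤ Real.arsinh (dist w0 w / (2 * s)) := by
    rw [← Real.arsinh_sinh x]; exact Real.arsinh_le_arsinh.mpr h1
  linarith

theorem aux_vert {f : ℂ → ℂ} {β B : ℝ} (hβ0 : 0 < β) (hβ1 : β ≤ 1) (hB : 0 < B)
    (hf : DifferentiableOn ℂ f UHP)
    (hb : ∀ w ∈ UHP, ‖deriv f w‖ ≤ B * (1 + w.im ^ (β - 1)))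
    {w : ℂ} (hw : w ∈ UHP) {r : ℝ} (hr : 0 ≤ r) :
    ‖f (w + r * I) - f w‖ ≤ B * (r + r ^ β / β) := by
  have hw0 : 0 < w.im := hw
  have him : ∀ t : ℝ, (w + t * I).im = w.im + t := by intro t; simp
  have hmem : ∀ t : ℝ, 0 ≤ t → w + t * I ∈ UHP := by
    intro t ht; change 0 < (w + t * I).im; rw [him]; linarith
  have hder : ∀ t : ℝ, 0 ≤ t → HasDerivAt (fun s : ℝ => f (w + s * I) - f w)
      (deriv f (w + t * I) * I) t := by
    intro t ht
    have h1 : HasDerivAt f (deriv f (w + t * I)) (w + t * I) :=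
      (hf.differentiableAt (aux_isOpen_UHP.mem_nhds (hmem t ht))).hasDerivAt
    have h2 : HasDerivAt (fun s : ℝ => w + (s:ℂ) * I) I t := by
      simpa using ((Complex.ofRealCLM.hasDerivAt (x := t)).mul_const I).const_add w
    exact (h1.comp t h2).sub_const (f w)
  have hBd : ∀ t : ℝ, 0 ≤ t → HasDerivAt
      (fun s : ℝ => B * (s + ((w.im + s) ^ β - w.im ^ β) / β))
      (B * (1 + (w.im + t) ^ (β - 1))) t := by
    intro t ht
    have h1 : HasDerivAt (fun s : ℝ => (w.im + s) ^ β) (1 * β * (w.im + t) ^ (β - 1)) t :=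
      ((hasDerivAt_id t).const_add w.im).rpow_const (Or.inl (by simp; linarith))
    have h2 := (((hasDerivAt_id t).add ((h1.sub_const (w.im ^ β)).div_const β))).const_mul B
    refine h2.congr_deriv ?_
    field_simp
  have key := image_norm_le_of_norm_deriv_right_le_deriv_boundary' (a := 0) (b := r)
    (f := fun s : ℝ => f (w + s * I) - f w) (f' := fun t => deriv f (w + t * I) * I)
    (B := fun s : ℝ => B * (s + ((w.im + s) ^ β - w.im ^ β) / β))
    (B' := fun t => B * (1 + (w.im + t) ^ (β - 1)))
    (fun t ht => (hder t ht.1).continuousAt.continuousWithinAt)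
    (fun t ht => (hder t ht.1).hasDerivWithinAt)
    (by simp)
    (fun t ht => (hBd t ht.1).continuousAt.continuousWithinAt)
    (fun t ht => (hBd t ht.1).hasDerivWithinAt)
    (fun t ht => by
      have := hb _ (hmem t ht.1)
      rw [him] at this
      simpa using this) ⟨hr, le_rfl⟩
  refine key.trans ?_
  have h3 : (w.im + r) ^ β ≤ w.im ^ β + r ^ β := Real.rpow_add_le_add_rpow hw0.le hr hβ0.le hβ1
  have h4 : (w.im + r) ^ β - w.im ^ β ≤ r ^ β := by linarith
  gcongr

theorem aux_holder {f : ℂ → ℂ} {β B : ℝ} (hβ0 : 0 < β) (hβ1 : β ≤ 1) (hB : 0 < B)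
    (hf : DifferentiableOn ℂ f UHP)
    (hb : ∀ w ∈ UHP, ‖deriv f w‖ ≤ B * (1 + w.im ^ (β - 1))) :
    IsHolder f β (B * (2 / β + 4)) := by
  intro z hz z' hz'
  set r := dist z z' with hr
  by_cases hr0 : r = 0
  · have : z = z' := dist_eq_zero.mp hr0
    rw [this, dist_self]
    have : 0 ≤ max (r ^ β) r := le_max_of_le_right dist_nonneg
    positivity
  have hrp : 0 < r := lt_of_le_of_ne dist_nonneg (Ne.symm hr0)
  have h1 := aux_vert hβ0 hβ1 hB hf hb hz hrp.le
  have h2 := aux_vert hβ0 hβ1 hB hf hb hz' hrp.le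
  have h3 : ‖f (z + r * I) - f (z' + r * I)‖ ≤ B * (1 + r ^ (β - 1)) * ‖(z + r * I) - (z' + r * I)‖ := by
    have hconv : Convex ℝ {u : ℂ | r ≤ u.im} := convex_halfSpace_im_ge r
    refine hconv.norm_image_sub_le_of_norm_deriv_le (f := f) (fun u hu => ?_) (fun u hu => ?_) ?_ ?_
    · exact hf.differentiableAt (aux_isOpen_UHP.mem_nhds (lt_of_lt_of_le hrp hu))
    · refine (hb u (lt_of_lt_of_le hrp hu)).trans ?_
      have : u.im ^ (β - 1) ≤ r ^ (β - 1) :=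
        Real.rpow_le_rpow_of_nonpos hrp hu (by linarith)
      gcongr
    · have : 0 < z'.im := hz'
      change r ≤ (z' + r * I).im
      simp; linarith
    · have : 0 < z.im := hz
      change r ≤ (z + r * I).im
      simp; linarith
  have e : ‖(z + r * I) - (z' + r * I)‖ = r := by rw [hr, dist_eq_norm]; congr 1; ring
  rw [e] at h3
  have e2 : B * (1 + r ^ (β - 1)) * r = B * (r + r ^ β) := by
    have : r ^ (β - 1) * r = r ^ β := by
      rw [Real.rpow_sub_one hr0]; field_simp
    rw [← this]; ring
  rw [e2] at h3
  have h4 : ‖f z - f z'‖ ≤ ‖f (z + r * I) - f z‖ + ‖f (z + r * I) - f (z' + r * I)‖ +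
      ‖f (z' + r * I) - f z'‖ := by
    have : f z - f z' = -(f (z + r * I) - f z) + (f (z + r * I) - f (z' + r * I)) +
      (f (z' + r * I) - f z') := by ring
    rw [this]
    refine (norm_add₃_le).trans ?_
    rw [norm_neg]
  rw [dist_eq_norm]
  refine h4.trans ?_
  set m := max (r ^ β) r with hm
  have m1 : r ^ β ≤ m := le_max_left _ _
  have m2 : r ≤ m := le_max_right _ _
  have m3 : r ^ β / β ≤ m / β := by gcongr
  have : B * (r + r ^ β / β) + B * (r + r ^ β) + B * (r + r ^ β / β) ≤ B * (2 / β + 4) * m + 0 := by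
    have : B * (2/β + 4) * m = B * (2 * (m / β) + 4 * m) := by ring
    rw [this, add_zero, ← mul_add, ← mul_add]
    apply mul_le_mul_of_nonneg_left _ hB.le
    linarith
  linarith

theorem aux_diam_pos {K : Set ℂ} (hK : IsHull K) (hne : K.Nonempty) {p : ℂ} (hp : p ∈ closure K)
    (hp0 : p.im = 0) : 0 < Metric.diam K := by
  obtain ⟨k, hk⟩ := hne
  have h1 : dist k p ≤ Metric.diam K := by
    rw [← Metric.diam_closure]
    exact Metric.dist_le_diam_of_mem hK.1.closure (subset_closure hk) hp
  refine lt_of_lt_of_le (dist_pos.mpr ?_) h1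
  rintro rfl
  have : 0 < k.im := hK.2.1 hk
  linarith

/-- **Lemma `derivative`.** Logarithmic growth of the hyperbolic metric
from a suitable base-point implies the Hölder property of `Ω = ℍ \ K`. -/
theorem hyperbolic_growth_implies_holder (β C R : ℝ) (hβ0 : 0 < β) (hβ1 : β ≤ 1)
    (hC : 0 < C) :
    ∃ C' > 0, ∀ (K : Set ℂ) (f g : ℂ → ℂ) (z₀ : ℂ),
      IsHull K → K.Nonempty → IsHydroPair K f g →
      10 * Metric.diam K ≤ R →
      z₀ ∈ UHP \ K → R ≤ z₀.im → infDist z₀ K ≤ 100 * R →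
      (∀ z ∈ UHP \ K, infDist z K ≤ 10 * Metric.diam K →
        rhoVia f z₀ z ≤
          (1/β) * Real.log (1 / infDist z (frontier (UHP \ K))) + C) →
      IsHolder f β C' := by
  by_cases hR : 0 < R
  swap
  · -- for nonpositive `R` the hypotheses are contradictory
    refine ⟨1, one_pos, ?_⟩
    intro K f g z₀ hK hne hpair hdR hz₀ hRz hdist hyp
    exfalso
    obtain ⟨p, hp, hp0⟩ := aux_hull_touch hK hne
    have hd := aux_diam_pos hK hne hp hp0
    linarith
  set B : ℝ := 800 + 400 * (Real.exp (β * C) * (R / 2) ^ (-β)) with hBdef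
  have hE : 0 < Real.exp (β * C) * (R / 2) ^ (-β) := by positivity
  have hB : 0 < B := by positivity
  refine ⟨B * (2 / β + 4), by positivity, ?_⟩
  intro K f g z₀ hK hne hpair hdR hz₀ hRz hdist hyp
  obtain ⟨p, hp, hp0⟩ := aux_hull_touch hK hne
  set d := Metric.diam K with hddef
  have hd : 0 < d := aux_diam_pos hK hne hp hp0
  have hKp : ∀ k ∈ K, ‖k - p‖ ≤ d := by
    intro k hk
    rw [← dist_eq_norm, hddef, ← Metric.diam_closure]
    exact Metric.dist_le_diam_of_mem hK.1.closure (subset_closure hk) hp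
  obtain ⟨hmf, hmg, hgc⟩ := aux_inv_cont hpair hK.2.2.1
  have hgrow := aux_growth hK hpair hd hp0 hKp
  have hfd := hpair.1.1
  have hinj := hpair.1.2.1
  refine aux_holder hβ0 hβ1 hB hfd ?_
  intro w hw
  have hw0 : 0 < w.im := hw
  have hballsub : ball w w.im ⊆ UHP := by
    intro u hu
    have h1 := Complex.abs_im_le_norm (u - w)
    rw [← dist_eq_norm, Complex.sub_im] at h1
    have h2 : dist u w < w.im := hu
    have := (abs_le.mp h1).1
    change 0 < u.im
    linarith
  have hkoebe : ∀ a ∉ UHP \ K, ‖deriv f w‖ * w.im ≤ 400 * ‖f w - a‖ := by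
    intro a ha
    refine aux_koebe hw0 (hfd.mono hballsub) (hinj.mono hballsub) ?_
    rintro ⟨u, hu, rfl⟩
    exact ha (hmf (hballsub hu))
  have hy0 : 0 < w.im ^ (β - 1) := Real.rpow_pos_of_pos hw0 _
  by_cases hnear : infDist (f w) K ≤ 10 * d
  · -- near the hull
    have hrho := hyp (f w) (hmf hw) hnear
    set Ω := UHP \ K with hΩ
    set δ := infDist (f w) (frontier Ω) with hδ
    have hfr : (frontier Ω).Nonempty := by
      rw [nonempty_frontier_iff]
      refine ⟨⟨f w, hmf hw⟩, fun h => ?_⟩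
      have : (0:ℂ) ∈ Ω := by rw [h]; trivial
      have : (0:ℝ) < (0:ℂ).im := this.1
      simp at this
    obtain ⟨a, ha, hda⟩ := isClosed_frontier.exists_infDist_eq_dist hfr (f w)
    have haΩ : a ∉ Ω := by
      rw [hK.2.2.1.frontier_eq] at ha
      exact ha.2
    have hδ0 : 0 < δ := by
      rw [hδ, hda]
      refine dist_pos.mpr ?_
      intro h
      exact haΩ (h ▸ hmf hw)
    have hk := hkoebe a haΩ
    rw [← dist_eq_norm, ← hda, ← hδ] at hk
    -- lower bound for the hyperbolic distance
    set w₀ := g z₀ with hw₀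
    have hw₀U : w₀ ∈ UHP := hmg hz₀
    have hfw₀ : f w₀ = z₀ := hpair.2.2 hz₀
    have i1 : invFunOn f UHP (f w) = w := hinj.leftInvOn_invFunOn hw
    have i2 : invFunOn f UHP z₀ = w₀ := by
      rw [← hfw₀]; exact hinj.leftInvOn_invFunOn hw₀U
    have hw₀p : 0 < w₀.im := hw₀U
    have him₀ : R / 2 ≤ w₀.im := by
      have h1 := hgrow w₀ hw₀U (by
        rw [hfw₀]
        have h2 := Complex.abs_im_le_norm (z₀ - p)
        rw [Complex.sub_im, hp0, sub_zero] at h2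
        have := le_abs_self z₀.im
        linarith)
      rw [hfw₀] at h1
      linarith
    unfold rhoVia at hrho
    rw [i1, i2] at hrho
    have h3 := (aux_rho hw₀p hw0).trans hrho
    rw [one_div δ, Real.log_inv, Real.log_div hw₀p.ne' hw0.ne'] at h3
    have h4 : Real.log δ ≤ β * C + β * Real.log w.im - β * Real.log w₀.im := by
      have h5 := mul_le_mul_of_nonneg_left h3 hβ0.le
      have h6 : β * (1 / β * -Real.log δ + C) = - Real.log δ + β * C := by field_simp
      rw [h6] at h5
      linarith
    have h5 : δ ≤ Real.exp (β * C) * w.im ^ β * w₀.im ^ (-β) := by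
      rw [Real.rpow_def_of_pos hw0, Real.rpow_def_of_pos hw₀p, ← Real.exp_add, ← Real.exp_add,
        ← Real.log_le_iff_le_exp hδ0]
      linarith
    have h6 : w₀.im ^ (-β) ≤ (R / 2) ^ (-β) :=
      Real.rpow_le_rpow_of_nonpos (by positivity) him₀ (by linarith)
    have h7 : δ ≤ Real.exp (β * C) * w.im ^ β * (R / 2) ^ (-β) :=
      h5.trans (by gcongr)
    have h8 : w.im ^ β = w.im ^ (β - 1) * w.im := by
      rw [Real.rpow_sub_one hw0.ne']; field_simp
    have h9 : ‖deriv f w‖ * w.im ≤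
        (400 * (Real.exp (β * C) * (R / 2) ^ (-β)) * w.im ^ (β - 1)) * w.im := by
      refine hk.trans ?_
      rw [h8] at h7
      linarith
    have h10 := le_of_mul_le_mul_right h9 hw0
    refine h10.trans ?_
    rw [hBdef]
    nlinarith [mul_pos hE hy0]
  · -- far from the hull
    push Not at hnear
    have h1 : 4 * d ≤ ‖f w - p‖ := by
      rw [← infDist_closure] at hnear
      have := infDist_le_dist_of_mem (x := f w) hp
      rw [dist_eq_norm] at this
      linarith
    have h2 := hgrow w hw h1
    have him : 0 < (f w).im := (hmf hw).1
    have h3 := hkoebe (((f w).re : ℝ) : ℂ) (by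
      intro h
      have : 0 < ((((f w).re : ℝ) : ℂ)).im := h.1
      simp at this)
    have h4 : f w - (((f w).re : ℝ) : ℂ) = ((f w).im : ℂ) * I := by
      apply Complex.ext <;> simp
    rw [h4, norm_mul, Complex.norm_I, Complex.norm_real, Real.norm_eq_abs, abs_of_pos him] at h3
    have h5 : ‖deriv f w‖ * w.im ≤ 800 * w.im := by linarith
    have h6 := le_of_mul_le_mul_right h5 hw0
    refine h6.trans ?_
    rw [hBdef]
    nlinarith [mul_pos hE hy0]
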